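/- arXiv:1201.0520 — 5 statements merged into one kernel-verified Lean document; each statement's English description precedes it below -/
import Mathlib

section
/- There exists a positive constant C such that for every weight w: [w]_{A_∞^{d,B}} ≤ C log [w]_{A_∞^d}, where [w]_{A_∞^d} := sup_{J ∈ 𝒟} ⟨w⟩_J e^{−⟨log w⟩_J} and [w]_{A_∞^{d,B}} := inf { Q > 0 : for every J ∈ 𝒟, (1/|J|) Σ_{I ∈ 𝒟(J)} (Δ_I w / ⟨w⟩_I)² |I| ≤ Q }. In particular, if w ∈ A_∞^d then [w]_{A_∞^{d,B}} is finite. -/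
open MeasureTheory Real
open scoped ENNReal

noncomputable section

/-- The average `⟨w⟩_{[a,b]} = (b-a)⁻¹ ∫_a^b w`. -/
def avg (w : ℝ → ℝ) (a b : ℝ) : ℝ := (b - a)⁻¹ * ∫ x in a..b, w x

/-- A weight: a locally integrable function on `ℝ` that is positive almost everywhere. -/
def IsWeight (w : ℝ → ℝ) : Prop :=
  LocallyIntegrable w volume ∧ ∀ᵐ x : ℝ, 0 < w x

/-- Endpoints of the `k`-th subinterval of `[a,b]` at bisection level `n`; as `n, k` range over
`n : ℕ`, `k < 2^n` these enumerate the family `𝒟(J)` obtained from `J = [a,b]` by repeated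
bisection (including `J` itself, for `n = 0`). -/
def subInt (a b : ℝ) (n k : ℕ) : ℝ × ℝ :=
  (a + k * ((b - a) / 2 ^ n), a + (k + 1) * ((b - a) / 2 ^ n))

/-- Midpoint of an interval. -/
def mid (a b : ℝ) : ℝ := (a + b) / 2

/-- `Δ_I w` for `I = [a,b]`: the difference of the averages of `w` over the two halves of `I`. -/
def delta (w : ℝ → ℝ) (a b : ℝ) : ℝ := avg w a (mid a b) - avg w (mid a b) b

/-- `(1/|J|) Σ_{I ∈ 𝒟(J)} (Δ_I w)² g(⟨w⟩_I) |I|` for `J = [a,b]`. -/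
def bellmanSum (w : ℝ → ℝ) (a b : ℝ) (g : ℝ → ℝ) : ℝ :=
  (b - a)⁻¹ * ∑' n : ℕ, ∑ k ∈ Finset.range (2 ^ n),
    delta w (subInt a b n k).1 (subInt a b n k).2 ^ 2 *
      g (avg w (subInt a b n k).1 (subInt a b n k).2) * ((b - a) / 2 ^ n)

/-- `(1/|J|) Σ_{I ∈ 𝒟(J)} (Δ_I w / ⟨w⟩_I)² g(⟨w⟩_I) |I|` for `J = [a,b]`. -/
def buckleySum (w : ℝ → ℝ) (a b : ℝ) (g : ℝ → ℝ) : ℝ :=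
  (b - a)⁻¹ * ∑' n : ℕ, ∑ k ∈ Finset.range (2 ^ n),
    (delta w (subInt a b n k).1 (subInt a b n k).2 /
        avg w (subInt a b n k).1 (subInt a b n k).2) ^ 2 *
      g (avg w (subInt a b n k).1 (subInt a b n k).2) * ((b - a) / 2 ^ n)

/-- `ℝ≥0∞`-valued version of `buckleySum` (the summands are nonnegative). -/
def buckleySumE (w : ℝ → ℝ) (a b : ℝ) (g : ℝ → ℝ) : ℝ≥0∞ :=
  ENNReal.ofReal ((b - a)⁻¹) * ∑' n : ℕ, ∑ k ∈ Finset.range (2 ^ n),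
    ENNReal.ofReal
      ((delta w (subInt a b n k).1 (subInt a b n k).2 /
          avg w (subInt a b n k).1 (subInt a b n k).2) ^ 2 *
        g (avg w (subInt a b n k).1 (subInt a b n k).2) * ((b - a) / 2 ^ n))

/-- `w` is doubling with constant `D` on the bisection family of `[a,b]`:
`⟨w⟩_I ≤ D ⟨w⟩_{I⁺}` and `⟨w⟩_I ≤ D ⟨w⟩_{I⁻}` for every `I ∈ 𝒟(J)` (including `I = J`). -/
def DoublingOn (D : ℝ) (w : ℝ → ℝ) (a b : ℝ) : Prop :=
  ∀ n : ℕ, ∀ k < 2 ^ n,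
    avg w (subInt a b n k).1 (subInt a b n k).2 ≤
        D * avg w (subInt a b n k).1 (mid (subInt a b n k).1 (subInt a b n k).2) ∧
      avg w (subInt a b n k).1 (subInt a b n k).2 ≤
        D * avg w (mid (subInt a b n k).1 (subInt a b n k).2) (subInt a b n k).2

/-- Endpoints of the dyadic interval `[k·2^{-j}, (k+1)·2^{-j})` of the grid `𝒟`. -/
def dyad (j k : ℤ) : ℝ × ℝ := ((k : ℝ) * (2 : ℝ) ^ (-j), ((k : ℝ) + 1) * (2 : ℝ) ^ (-j))

/-- `w` is dyadically doubling with constant `D`: the average over any dyadic interval is at most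
`D` times the average over each of its two dyadic children, i.e. `⟨w⟩_{F(I)} ≤ D ⟨w⟩_I` for every
`I ∈ 𝒟` with dyadic parent `F(I)`. -/
def DyadicDoubling (D : ℝ) (w : ℝ → ℝ) : Prop :=
  ∀ j k : ℤ,
    avg w (dyad j k).1 (dyad j k).2 ≤
        D * avg w (dyad (j + 1) (2 * k)).1 (dyad (j + 1) (2 * k)).2 ∧
      avg w (dyad j k).1 (dyad j k).2 ≤
        D * avg w (dyad (j + 1) (2 * k + 1)).1 (dyad (j + 1) (2 * k + 1)).2

/-- The dyadic Buckley `A_∞` constant `[w]_{A_∞^{d,B}}`. -/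
def AInfBuckleyConst (w : ℝ → ℝ) : ℝ≥0∞ :=
  sInf {Q : ℝ≥0∞ | 0 < Q ∧ ∀ j k : ℤ,
    buckleySumE w (dyad j k).1 (dyad j k).2 (fun _ => (1 : ℝ)) ≤ Q}

theorem sum_range_two_pow_succ (f : ℕ → ℝ) (n : ℕ) :
    ∑ k ∈ Finset.range (2 ^ (n + 1)), f k =
      ∑ k ∈ Finset.range (2 ^ n), (f (2 * k) + f (2 * k + 1)) := by
  have h : ∀ m : ℕ, ∑ k ∈ Finset.range (2 * m), f k =
      ∑ k ∈ Finset.range m, (f (2 * k) + f (2 * k + 1)) := by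
    intro m
    induction m with
    | zero => simp
    | succ m ih =>
      rw [Finset.sum_range_succ, ← ih, show 2 * (m + 1) = 2 * m + 1 + 1 by ring,
        Finset.sum_range_succ, Finset.sum_range_succ]
      ring
  rw [pow_succ, mul_comm]
  exact h _

theorem MeasureTheory.LocallyIntegrable.intervalIntegrable_real {w : ℝ → ℝ}
    (hw : LocallyIntegrable w volume) (a b : ℝ) : IntervalIntegrable w volume a b :=
  intervalIntegrable_iff.2
    ((hw.integrableOn_isCompact isCompact_uIcc).mono_set Set.uIoc_subset_uIcc)

theorem avg_eq_avg_halves {w : ℝ → ℝ} (hw : LocallyIntegrable w volume) {a b : ℝ} (hab : a < b) :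
    avg w a b = (avg w a (mid a b) + avg w (mid a b) b) / 2 := by
  have h := intervalIntegral.integral_add_adjacent_intervals
    (hw.intervalIntegrable_real a (mid a b)) (hw.intervalIntegrable_real (mid a b) b)
  have hba : b - a ≠ 0 := (sub_pos.2 hab).ne'
  have h1 : mid a b - a = (b - a) / 2 := by unfold mid; ring
  have h2 : b - mid a b = (b - a) / 2 := by unfold mid; ring
  rw [avg, avg, avg, ← h, h1, h2]
  field_simp

theorem subInt_fst_lt_snd {a b : ℝ} (hab : a < b) (n k : ℕ) :
    (subInt a b n k).1 < (subInt a b n k).2 := by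
  have : 0 < (b - a) / 2 ^ n := div_pos (sub_pos.2 hab) (by positivity)
  simp only [subInt]
  linarith

theorem subInt_succ_even (a b : ℝ) (n k : ℕ) :
    subInt a b (n + 1) (2 * k) =
      ((subInt a b n k).1, mid (subInt a b n k).1 (subInt a b n k).2) := by
  ext <;> simp only [subInt, mid] <;> push_cast <;> field_simp <;> ring

theorem subInt_succ_odd (a b : ℝ) (n k : ℕ) :
    subInt a b (n + 1) (2 * k + 1) =
      (mid (subInt a b n k).1 (subInt a b n k).2, (subInt a b n k).2) := by
  ext <;> simp only [subInt, mid] <;> push_cast <;> field_simp <;> ring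

theorem avg_pos {w : ℝ → ℝ} (hw : IsWeight w) {a b : ℝ} (hab : a < b) : 0 < avg w a b := by
  refine mul_pos (inv_pos.2 (sub_pos.2 hab)) ?_
  rw [intervalIntegral.integral_of_le hab.le, setIntegral_pos_iff_support_of_nonneg_ae]
  · have h : ∀ᵐ x : ℝ, x ∈ Function.support w := by
      filter_upwards [hw.2] with x hx using hx.ne'
    rw [Measure.measure_inter_eq_of_ae h]
    simpa using hab
  · exact ae_restrict_of_ae (hw.2.mono fun x hx => hx.le)
  · exact (intervalIntegrable_iff_integrableOn_Ioc_of_le hab.le).1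
      (hw.1.intervalIntegrable_real a b)

theorem avg_log_le_log_avg {w : ℝ → ℝ} (hw : IsWeight w)
    (hl : LocallyIntegrable (fun x => Real.log (w x)) volume) {a b : ℝ} (hab : a < b) :
    avg (fun x => Real.log (w x)) a b ≤ Real.log (avg w a b) := by
  have hm := avg_pos hw hab
  set m := avg w a b with hmdef
  have hba : 0 < b - a := sub_pos.2 hab
  have hint : ∫ x in a..b, w x = (b - a) * m := by
    rw [hmdef, avg]; field_simp
  have hwi := hw.1.intervalIntegrable_real a b
  have h : ∫ x in a..b, Real.log (w x) ≤ ∫ x in a..b, (w x / m + (Real.log m - 1)) := by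
    refine intervalIntegral.integral_mono_ae hab.le (hl.intervalIntegrable_real a b)
      ((hwi.div_const m).add intervalIntegrable_const) ?_
    filter_upwards [hw.2] with x hx
    have := Real.log_le_sub_one_of_pos (div_pos hx hm)
    rw [Real.log_div hx.ne' hm.ne'] at this
    linarith
  rw [intervalIntegral.integral_add (hwi.div_const m) intervalIntegrable_const,
    intervalIntegral.integral_div, hint, intervalIntegral.integral_const, smul_eq_mul] at h
  rw [avg, inv_mul_le_iff₀ hba]
  refine h.trans_eq ?_
  field_simp
  ring

/-- Quantitative concavity of the logarithm at a midpoint. -/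
theorem sq_sub_div_midpoint_le {u v : ℝ} (hu : 0 < u) (hv : 0 < v) :
    ((u - v) / ((u + v) / 2)) ^ 2 ≤
      8 * (Real.log ((u + v) / 2) - (Real.log u + Real.log v) / 2) := by
  have hm : 0 < (u + v) / 2 := by positivity
  have h := Real.log_le_sub_one_of_pos (show 0 < u * v / ((u + v) / 2) ^ 2 by positivity)
  rw [Real.log_div (by positivity) (by positivity), Real.log_mul hu.ne' hv.ne', Real.log_pow] at h
  have h' : u * v / ((u + v) / 2) ^ 2 - 1 = -((u - v) / ((u + v) / 2)) ^ 2 / 4 := by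
    field_simp
    ring
  rw [h'] at h
  push_cast at h
  linarith

theorem avg_eq_sum_subInt {φ : ℝ → ℝ} (hφ : LocallyIntegrable φ volume) {a b : ℝ} (hab : a < b)
    (n : ℕ) :
    avg φ a b =
      (∑ k ∈ Finset.range (2 ^ n), avg φ (subInt a b n k).1 (subInt a b n k).2) / 2 ^ n := by
  induction n with
  | zero => simp [subInt]
  | succ n ih =>
    rw [ih, sum_range_two_pow_succ, pow_succ, mul_comm, ← div_div, Finset.sum_div _ _ (2 : ℝ)]
    congr 1
    refine Finset.sum_congr rfl fun k _ => ?_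
    rw [subInt_succ_even, subInt_succ_odd]
    exact avg_eq_avg_halves hφ (subInt_fst_lt_snd hab n k)

theorem sum_delta_div_avg_sq_le {w : ℝ → ℝ} (hw : IsWeight w) {a b : ℝ} (hab : a < b) (N : ℕ) :
    ∑ n ∈ Finset.range N, ∑ k ∈ Finset.range (2 ^ n),
      (delta w (subInt a b n k).1 (subInt a b n k).2 /
        avg w (subInt a b n k).1 (subInt a b n k).2) ^ 2 * ((b - a) / 2 ^ n) ≤
      8 * (b - a) * (Real.log (avg w a b) -
        (∑ k ∈ Finset.range (2 ^ N),
          Real.log (avg w (subInt a b N k).1 (subInt a b N k).2)) / 2 ^ N) := by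
  induction N with
  | zero => simp [subInt]
  | succ N ih =>
    rw [Finset.sum_range_succ]
    have hstep : ∑ k ∈ Finset.range (2 ^ N),
        (delta w (subInt a b N k).1 (subInt a b N k).2 /
          avg w (subInt a b N k).1 (subInt a b N k).2) ^ 2 * ((b - a) / 2 ^ N) ≤
        8 * (b - a) * ((∑ k ∈ Finset.range (2 ^ N),
          Real.log (avg w (subInt a b N k).1 (subInt a b N k).2)) / 2 ^ N -
          (∑ k ∈ Finset.range (2 ^ (N + 1)),
            Real.log (avg w (subInt a b (N + 1) k).1 (subInt a b (N + 1) k).2)) /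
              2 ^ (N + 1)) := by
      rw [sum_range_two_pow_succ, Finset.sum_div, Finset.sum_div, ← Finset.sum_sub_distrib,
        Finset.mul_sum]
      refine Finset.sum_le_sum fun k _ => ?_
      rw [subInt_succ_even, subInt_succ_odd]
      have hlt := subInt_fst_lt_snd hab N k
      generalize (subInt a b N k).1 = c at *
      generalize (subInt a b N k).2 = d at *
      have hu : 0 < avg w c (mid c d) := avg_pos hw (by unfold mid; linarith)
      have hv : 0 < avg w (mid c d) d := avg_pos hw (by unfold mid; linarith)
      have hpos : 0 ≤ (b - a) / 2 ^ N := div_nonneg (sub_pos.2 hab).le (by positivity)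
      rw [delta, avg_eq_avg_halves hw.1 hlt]
      refine (mul_le_mul_of_nonneg_right (sq_sub_div_midpoint_le hu hv) hpos).trans_eq ?_
      rw [pow_succ]
      field_simp
    linarith

theorem buckleySumE_one_le {w : ℝ → ℝ} (hw : IsWeight w)
    (hl : LocallyIntegrable (fun x => Real.log (w x)) volume) {a b : ℝ} (hab : a < b) :
    buckleySumE w a b (fun _ => (1 : ℝ)) ≤
      ENNReal.ofReal (8 * (Real.log (avg w a b) - avg (fun x => Real.log (w x)) a b)) := by
  have hba : 0 < b - a := sub_pos.2 hab
  have htsum : ∑' n : ℕ, ∑ k ∈ Finset.range (2 ^ n),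
      ENNReal.ofReal ((delta w (subInt a b n k).1 (subInt a b n k).2 /
          avg w (subInt a b n k).1 (subInt a b n k).2) ^ 2 * 1 * ((b - a) / 2 ^ n)) ≤
      ENNReal.ofReal
        (8 * (b - a) * (Real.log (avg w a b) - avg (fun x => Real.log (w x)) a b)) := by
    refine ENNReal.tsum_le_of_sum_range_le fun N => ?_
    have hnn : ∀ n k : ℕ, 0 ≤ (delta w (subInt a b n k).1 (subInt a b n k).2 /
        avg w (subInt a b n k).1 (subInt a b n k).2) ^ 2 * ((b - a) / 2 ^ n) := fun n k => by
      positivity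
    simp only [mul_one]
    simp_rw [← ENNReal.ofReal_sum_of_nonneg fun k _ => hnn _ k]
    rw [← ENNReal.ofReal_sum_of_nonneg fun n _ => Finset.sum_nonneg fun k _ => hnn n k]
    refine ENNReal.ofReal_le_ofReal ((sum_delta_div_avg_sq_le hw hab N).trans ?_)
    rw [avg_eq_sum_subInt hl hab N]
    gcongr with k _
    exact avg_log_le_log_avg hw hl (subInt_fst_lt_snd hab N k)
  refine (mul_le_mul_right htsum _).trans_eq ?_
  rw [← ENNReal.ofReal_mul (by positivity)]
  congr 1
  field_simp

theorem dyad_fst_lt_snd (j k : ℤ) : (dyad j k).1 < (dyad j k).2 := by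
  have : (0 : ℝ) < 2 ^ (-j) := by positivity
  simp only [dyad]
  linarith

/-- Theorem II.7, part (4), dyadic case:
`[w]_{A_∞^{d,B}} ≤ C log [w]_{A_∞^d}`, phrased via upper bounds `Q` for the
`A_∞^d` quantities `⟨w⟩_J e^{-⟨log w⟩_J}` (`[w]_{A_∞^d}` is their supremum). -/
theorem aInf_buckley_upper :
    ∃ C : ℝ, 0 < C ∧ ∀ w : ℝ → ℝ, IsWeight w →
      LocallyIntegrable (fun x => Real.log (w x)) volume →
      ∀ Q : ℝ, 1 ≤ Q →
      (∀ j k : ℤ,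
        avg w (dyad j k).1 (dyad j k).2 *
          Real.exp (-avg (fun x => Real.log (w x)) (dyad j k).1 (dyad j k).2) ≤ Q) →
      AInfBuckleyConst w ≤ ENNReal.ofReal (C * Real.log Q) := by
  refine ⟨8, by norm_num, fun w hw hl Q hQ h => ?_⟩
  refine ENNReal.le_of_forall_pos_le_add fun ε hε _ => sInf_le ⟨by positivity, fun j k => ?_⟩
  have hlt := dyad_fst_lt_snd j k
  refine (buckleySumE_one_le hw hl hlt).trans (le_add_right (ENNReal.ofReal_le_ofReal ?_))
  have hm := avg_pos hw hlt
  have hlog := Real.log_le_log (by positivity) (h j k)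
  rw [Real.log_mul hm.ne' (Real.exp_pos _).ne', Real.log_exp] at hlog
  linarith
end
end

section
/- Let p > 1. There exists β > 0, depending only on p, such that for all real x > 0 and all t with 0 < t < x: x^p − ((x−t)^p + (x+t)^p)/2 + β t² x^{p−2} ≥ 0. Equivalently, for the function A(x) = x^p there is β > 0 with A(x) − (A(x−t) + A(x+t))/2 + (β/(p(p−1))) t² A''(x) ≥ 0 for 0 < t < x. -/
open MeasureTheory Real
open scoped ENNReal

noncomputable section

/-- Second-order upper bound for `(1 + v) ^ p` on `(-1, 1)`. -/
lemma exists_one_add_rpow_le (n : ℕ) : ∀ p : ℝ, 0 ≤ p → p ≤ n + 1 →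
    ∃ C : ℝ, 0 ≤ C ∧ ∀ v : ℝ, -1 < v → v < 1 → (1 + v) ^ p ≤ 1 + p * v + C * v ^ 2 := by
  induction n with
  | zero =>
    intro p hp hp1
    refine ⟨0, le_rfl, fun v hv _ => ?_⟩
    have := rpow_one_add_le_one_add_mul_self hv.le hp (by simpa using hp1)
    linarith
  | succ n ih =>
    intro p hp hp1
    by_cases h : p ≤ n + 1
    · exact ih p hp h
    have hn : (0 : ℝ) ≤ n := n.cast_nonneg
    push_cast at hp1
    obtain ⟨C, hC, hb⟩ := ih (p - 1) (by linarith) (by linarith)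
    refine ⟨p - 1 + 2 * C, by linarith, fun v hv hv1 => ?_⟩
    have hpos : 0 < 1 + v := by linarith
    have hsplit : (1 + v) ^ p = (1 + v) ^ (p - 1) * (1 + v) := by
      rw [← rpow_add_one hpos.ne', sub_add_cancel]
    have hmul := mul_le_mul_of_nonneg_right (hb v hv hv1) hpos.le
    have hcube : 0 ≤ C * v ^ 2 * (1 - v) := by
      have : 0 ≤ 1 - v := by linarith
      positivity
    rw [hsplit]
    linarith

/-- Proposition 1, third part: the case `A(x) = x^p`, `p > 1`. -/
theorem rpow_convexity_defect (p : ℝ) (hp : 1 < p) :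
    ∃ β : ℝ, 0 < β ∧ ∀ x t : ℝ, 0 < x → 0 < t → t < x →
      0 ≤ x ^ p - ((x - t) ^ p + (x + t) ^ p) / 2 + β * t ^ 2 * x ^ (p - 2) := by
  obtain ⟨n, hn⟩ := exists_nat_ge p
  obtain ⟨C, hC, hb⟩ := exists_one_add_rpow_le n p (by linarith) (by linarith)
  refine ⟨C + 1, by linarith, fun x t hx ht htx => ?_⟩
  obtain ⟨s, rfl⟩ : ∃ s, t = x * s := ⟨t / x, by field_simp⟩
  have hs : 0 < s := pos_of_mul_pos_right ht hx.le
  have hs1 : s < 1 := by nlinarith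
  have hsub : (x - x * s) ^ p = x ^ p * (1 + -s) ^ p := by
    rw [← mul_rpow hx.le (by linarith)]
    ring_nf
  have hadd : (x + x * s) ^ p = x ^ p * (1 + s) ^ p := by
    rw [← mul_rpow hx.le (by linarith)]
    ring_nf
  have hsq : x ^ p = x ^ (p - 2) * x ^ 2 := by
    rw [← rpow_natCast, ← rpow_add hx]
    norm_num
  have hneg := hb (-s) (by linarith) (by linarith)
  have hpos := hb s (by linarith) hs1
  have hscale : (C + 1) * (x * s) ^ 2 * x ^ (p - 2) = x ^ p * ((C + 1) * s ^ 2) := by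
    rw [hsq]
    ring
  rw [hsub, hadd, hscale]
  have hnonneg : 0 ≤ x ^ p * (1 - ((1 + -s) ^ p + (1 + s) ^ p) / 2 + (C + 1) * s ^ 2) :=
    mul_nonneg (rpow_nonneg hx.le p) (by nlinarith [sq_nonneg s])
  linarith
end
end

section
/- Let p > 1 and C > 1, and set A(x) = x^{−1/(p−1)} on (0,∞). Then there exists β > 0, depending only on p and C, such that for all x > 0 and all t with 0 < t < ((C−1)/C) x: A(x) − (A(x+t) + A(x−t))/2 + β t² A''(x) ≥ 0. -/
open MeasureTheory Real
open scoped ENNReal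

noncomputable section

/-- For `q ≤ 0`, the graph of `y ↦ y ^ q` on the positive reals lies above its tangents. -/
theorem rpow_tangent_le_of_nonpos {q y z : ℝ} (hq : q ≤ 0) (hy : 0 < y) (hz : 0 < z) :
    y ^ q + q * y ^ (q - 1) * (z - y) ≤ z ^ q := by
  have hu : 0 < z / y := div_pos hz hy
  have hlog := Real.log_le_sub_one_of_pos hu
  have hexp := Real.add_one_le_exp (Real.log (z / y) * q)
  rw [← Real.rpow_def_of_pos hu] at hexp
  have hbern : 1 + q * (z / y - 1) ≤ (z / y) ^ q := by nlinarith
  have hmul := mul_le_mul_of_nonneg_left hbern (Real.rpow_pos_of_pos hy q).le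
  rw [← Real.mul_rpow hy.le hu.le, mul_div_cancel₀ z hy.ne'] at hmul
  calc y ^ q + q * y ^ (q - 1) * (z - y) = y ^ q * (1 + q * (z / y - 1)) := by
        rw [Real.rpow_sub_one hy.ne']
        field_simp
    _ ≤ z ^ q := hmul

/-- Proposition 1, fourth part: the case `A(x) = x^{-1/(p-1)}`. -/
theorem neg_rpow_convexity_defect (p C : ℝ) (hp : 1 < p) (hC : 1 < C) :
    ∃ β : ℝ, 0 < β ∧ ∀ x t : ℝ, 0 < x → 0 < t → t < (C - 1) / C * x →
      0 ≤ x ^ (-1 / (p - 1)) - ((x + t) ^ (-1 / (p - 1)) + (x - t) ^ (-1 / (p - 1))) / 2 +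
        β * t ^ 2 *
          (1 / (p - 1) * (1 + 1 / (p - 1)) * x ^ (-2 - 1 / (p - 1))) := by
  obtain ⟨a, ha⟩ : ∃ a, a = 1 / (p - 1) := ⟨_, rfl⟩
  have ha0 : 0 < a := ha ▸ one_div_pos.mpr (by linarith)
  have hC0 : 0 < C := by linarith
  rw [neg_div, ← ha]
  refine ⟨C ^ (2 + a), Real.rpow_pos_of_pos hC0 _, fun x t hx ht htx => ?_⟩
  have hxC : x / C < x - t := by
    have h : (C - 1) / C * x = x - x / C := by field_simp
    linarith
  have hxt : 0 < x - t := (div_pos hx hC0).trans hxC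
  have hleft := rpow_tangent_le_of_nonpos (neg_nonpos.mpr ha0.le) hxt hx
  have hright := rpow_tangent_le_of_nonpos (neg_nonpos.mpr ha0.le) (add_pos hx ht) hx
  have hderiv := rpow_tangent_le_of_nonpos (q := -a - 1) (by linarith) hxt (add_pos hx ht)
  have hsecond : (x - t) ^ (-a - 1 - 1) ≤ C ^ (2 + a) * x ^ (-2 - a) := by
    calc (x - t) ^ (-a - 1 - 1) ≤ (x / C) ^ (-a - 1 - 1) :=
          Real.rpow_le_rpow_of_nonpos (div_pos hx hC0) hxC.le (by linarith)
      _ = C ^ (2 + a) * x ^ (-2 - a) := by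
          rw [Real.div_rpow hx.le hC0.le, show -a - 1 - 1 = -(2 + a) by ring,
            show -2 - a = -(2 + a) by ring, Real.rpow_neg hC0.le, div_inv_eq_mul, mul_comm]
  have hderiv' := mul_le_mul_of_nonneg_left hderiv (mul_pos ha0 ht).le
  have hsecond' := mul_le_mul_of_nonneg_left hsecond
    (show 0 ≤ a * (1 + a) * t ^ 2 by positivity)
  linarith
end
end

section
/- Let p > 1 and define f(v) := 1/v² − ((1−v)^{−1/(p−1)} + (1+v)^{−1/(p−1)}) / (2v²) for 0 < v < 1. Then f is decreasing on (0,1), i.e. f'(v) < 0 for all v ∈ (0,1). -/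
open MeasureTheory Real
open scoped ENNReal

noncomputable section

/-- Derivative of `v ↦ (1 - v) ^ s`. -/
theorem hasDerivAt_one_sub_rpow (s : ℝ) {v : ℝ} (hv : v < 1) :
    HasDerivAt (fun v : ℝ => (1 - v) ^ s) (-(s * (1 - v) ^ (s - 1))) v := by
  have h := ((hasDerivAt_id v).const_sub 1).rpow_const (p := s) (Or.inl (sub_pos.2 hv).ne')
  exact h.congr_deriv (by simp)

/-- Derivative of `v ↦ (1 + v) ^ s`. -/
theorem hasDerivAt_one_add_rpow (s : ℝ) {v : ℝ} (hv : 0 < 1 + v) :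
    HasDerivAt (fun v : ℝ => (1 + v) ^ s) (s * (1 + v) ^ (s - 1)) v := by
  have h := ((hasDerivAt_id v).const_add 1).rpow_const (p := s) (Or.inl hv.ne')
  exact h.congr_deriv (by simp)

/-- A function vanishing at `0` with positive derivative on `(0, 1)` is positive there. -/
theorem pos_of_hasDerivAt_pos {F F' : ℝ → ℝ} (h0 : F 0 = 0)
    (hF : ∀ v ∈ Set.Ico (0 : ℝ) 1, HasDerivAt F (F' v) v)
    (hpos : ∀ v ∈ Set.Ioo (0 : ℝ) 1, 0 < F' v) {v : ℝ} (hv : v ∈ Set.Ioo (0 : ℝ) 1) :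
    0 < F v := by
  have hmono : StrictMonoOn F (Set.Ico 0 1) := by
    refine strictMonoOn_of_deriv_pos (convex_Ico 0 1)
      (fun x hx => (hF x hx).continuousAt.continuousWithinAt) fun x hx => ?_
    rw [interior_Ico] at hx
    rw [(hF x ⟨hx.1.le, hx.2⟩).deriv]
    exact hpos x hx
  simpa [h0] using hmono ⟨le_rfl, one_pos⟩ ⟨hv.1.le, hv.2⟩ hv.1

/-- For `g v = (1 - v) ^ r + (1 + v) ^ r` with `r < 0`, one has `g' v < v * g'' v` on `(0, 1)`. -/
theorem rpow_second_order_pos {r v : ℝ} (hr : r < 0) (hv : v ∈ Set.Ioo (0 : ℝ) 1) :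
    0 < v * (r * (r - 1) * ((1 - v) ^ (r - 2) + (1 + v) ^ (r - 2))) -
      r * ((1 + v) ^ (r - 1) - (1 - v) ^ (r - 1)) := by
  refine pos_of_hasDerivAt_pos
    (F := fun v => v * (r * (r - 1) * ((1 - v) ^ (r - 2) + (1 + v) ^ (r - 2))) -
      r * ((1 + v) ^ (r - 1) - (1 - v) ^ (r - 1)))
    (F' := fun v => v * (-r * (1 - r) * (2 - r) * ((1 - v) ^ (r - 3) - (1 + v) ^ (r - 3))))
    (by simp) (fun x hx => ?_) (fun x hx => ?_) hv
  · have hx' : 0 < 1 + x := by linarith [hx.1]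
    have h := ((hasDerivAt_id x).mul (((hasDerivAt_one_sub_rpow (r - 2) hx.2).add
      (hasDerivAt_one_add_rpow (r - 2) hx')).const_mul (r * (r - 1)))).sub
      (((hasDerivAt_one_add_rpow (r - 1) hx').sub
        (hasDerivAt_one_sub_rpow (r - 1) hx.2)).const_mul r)
    refine h.congr_deriv ?_
    rw [show r - 2 - 1 = r - 3 by ring, show r - 1 - 1 = r - 2 by ring]
    simp only [id, Pi.add_apply]
    ring
  · have hlt : (1 + x) ^ (r - 3) < (1 - x) ^ (r - 3) :=
      Real.rpow_lt_rpow_of_neg (by linarith [hx.2]) (by linarith [hx.1]) (by linarith)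
    have h1 : 0 < -r := by linarith
    have h2 : 0 < 1 - r := by linarith
    have h3 : 0 < 2 - r := by linarith
    have h4 := sub_pos.2 hlt
    have h5 := hx.1
    positivity

/-- For `g v = (1 - v) ^ r + (1 + v) ^ r` with `r < 0`, one has `2 * g v < v * g' v + 4`
on `(0, 1)`. -/
theorem rpow_first_order_pos {r v : ℝ} (hr : r < 0) (hv : v ∈ Set.Ioo (0 : ℝ) 1) :
    0 < v * (r * ((1 + v) ^ (r - 1) - (1 - v) ^ (r - 1))) -
      2 * ((1 - v) ^ r + (1 + v) ^ r) + 4 := by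
  refine pos_of_hasDerivAt_pos
    (F := fun v => v * (r * ((1 + v) ^ (r - 1) - (1 - v) ^ (r - 1))) -
      2 * ((1 - v) ^ r + (1 + v) ^ r) + 4)
    (by norm_num) (fun x hx => ?_) (fun x hx => rpow_second_order_pos hr hx) hv
  have hx' : 0 < 1 + x := by linarith [hx.1]
  have h := (((hasDerivAt_id x).mul (((hasDerivAt_one_add_rpow (r - 1) hx').sub
    (hasDerivAt_one_sub_rpow (r - 1) hx.2)).const_mul r)).sub
    (((hasDerivAt_one_sub_rpow r hx.2).add (hasDerivAt_one_add_rpow r hx')).const_mul 2)).add_const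
    4
  refine h.congr_deriv ?_
  rw [show r - 1 - 1 = r - 2 by ring]
  simp only [id, Pi.sub_apply]
  ring

/-- Derivative of `v ↦ 1 / v ^ 2 - ((1 - v) ^ r + (1 + v) ^ r) / (2 * v ^ 2)`. -/
theorem hasDerivAt_inv_sq_sub_rpow (r : ℝ) {v : ℝ} (hv : v ∈ Set.Ioo (0 : ℝ) 1) :
    HasDerivAt (fun v : ℝ => 1 / v ^ 2 - ((1 - v) ^ r + (1 + v) ^ r) / (2 * v ^ 2))
      (-(v * (r * ((1 + v) ^ (r - 1) - (1 - v) ^ (r - 1))) -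
        2 * ((1 - v) ^ r + (1 + v) ^ r) + 4) / (2 * v ^ 3)) v := by
  have hv0 : v ≠ 0 := hv.1.ne'
  have h := ((hasDerivAt_const v (1 : ℝ)).fun_div (hasDerivAt_pow 2 v) (pow_ne_zero 2 hv0)).fun_sub
    (((hasDerivAt_one_sub_rpow r hv.2).fun_add
      (hasDerivAt_one_add_rpow r (by linarith [hv.1]))).fun_div
      ((hasDerivAt_pow 2 v).const_mul 2) (mul_ne_zero two_ne_zero (pow_ne_zero 2 hv0)))
  refine h.congr_deriv ?_
  field_simp
  push_cast
  ring

/-- Sublemma IV.1: the function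
`f(v) = 1/v² − ((1−v)^{−1/(p−1)} + (1+v)^{−1/(p−1)})/(2v²)` is decreasing on `(0,1)`,
i.e. `f'(v) < 0` there. -/
theorem sublemma_f_decreasing (p : ℝ) (hp : 1 < p) :
    StrictAntiOn
        (fun v : ℝ => 1 / v ^ 2 -
          ((1 - v) ^ (-1 / (p - 1)) + (1 + v) ^ (-1 / (p - 1))) / (2 * v ^ 2))
        (Set.Ioo 0 1) ∧
      ∀ v ∈ Set.Ioo (0 : ℝ) 1,
        deriv (fun v : ℝ => 1 / v ^ 2 -
          ((1 - v) ^ (-1 / (p - 1)) + (1 + v) ^ (-1 / (p - 1))) / (2 * v ^ 2)) v < 0 := by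
  have hr : -1 / (p - 1) < 0 := div_neg_of_neg_of_pos (by norm_num) (sub_pos.2 hp)
  have hd : ∀ v ∈ Set.Ioo (0 : ℝ) 1,
      deriv (fun v : ℝ => 1 / v ^ 2 -
        ((1 - v) ^ (-1 / (p - 1)) + (1 + v) ^ (-1 / (p - 1))) / (2 * v ^ 2)) v < 0 := by
    intro v hv
    rw [(hasDerivAt_inv_sq_sub_rpow _ hv).deriv]
    have hv0 := hv.1
    exact div_neg_of_neg_of_pos (neg_lt_zero.2 (rpow_first_order_pos hr hv)) (by positivity)
  refine ⟨strictAntiOn_of_deriv_neg (convex_Ioo 0 1)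
    (fun v hv => (hasDerivAt_inv_sq_sub_rpow _ hv).continuousAt.continuousWithinAt) ?_, hd⟩
  rwa [interior_Ioo]
end
end

section
/- Let Q > 1, let r := √(1 − 1/Q), and let γ ∈ (0,1] be the (unique) solution in (0,1] of γ − log γ − 1 = log Q. Then (1 + r)(γ + 1/γ − 2) + 2 r log(1 − r) ≥ 0. -/
open MeasureTheory Real
open scoped ENNReal

noncomputable section

/-- `2 log x ≤ x - 1/x` for `x ≥ 1`. -/
theorem two_mul_log_le_sub_inv {x : ℝ} (hx : 1 ≤ x) : 2 * Real.log x ≤ x - x⁻¹ := by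
  have h := Real.self_le_sinh_iff.mpr (Real.log_nonneg hx)
  rw [Real.sinh_log (by linarith)] at h
  linarith

/-- The second order Taylor polynomial of `-log (1 - r)` is a lower bound for `r ∈ [0, 1)`. -/
theorem add_sq_div_two_le_neg_log_one_sub {r : ℝ} (h0 : 0 ≤ r) (h1 : r < 1) :
    r + r ^ 2 / 2 ≤ -Real.log (1 - r) := by
  have h := Real.hasSum_pow_div_log_of_abs_lt_one (abs_lt.mpr ⟨by linarith, h1⟩)
  have h' := sum_le_hasSum (Finset.range 2) (fun i _ => by positivity) h
  norm_num [Finset.sum_range_succ] at h'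
  linarith

/-- `(1 + r) log (1 + r) ≤ -log (1 - r)` for `r ∈ [0, 1)`. -/
theorem one_add_mul_log_one_add_le {r : ℝ} (h0 : 0 ≤ r) (h1 : r < 1) :
    (1 + r) * Real.log (1 + r) ≤ -Real.log (1 - r) := by
  have hpos : 0 < 1 + r := by linarith
  have h := mul_le_mul_of_nonneg_left
    (two_mul_log_le_sub_inv (by linarith : (1 : ℝ) ≤ 1 + r)) hpos.le
  rw [mul_sub, mul_inv_cancel₀ hpos.ne'] at h
  nlinarith [add_sq_div_two_le_neg_log_one_sub h0 h1]

/-- Theorem IV.14: nonnegativity of `Δ(Q)` at the boundary configuration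
`z₋ ∈ Γ_Q`, `z₊ ∈ Γ`. -/
theorem boundary_delta_nonneg (Q r γ : ℝ) (hQ : 1 < Q)
    (hr : r = Real.sqrt (1 - 1 / Q)) (hγ0 : 0 < γ) (hγ1 : γ ≤ 1)
    (hγ : γ - Real.log γ - 1 = Real.log Q) :
    0 ≤ (1 + r) * (γ + 1 / γ - 2) + 2 * r * Real.log (1 - r) := by
  have hQ0 : 0 < Q := by linarith
  have hQinv : 1 / Q < 1 := (div_lt_one hQ0).mpr hQ
  have hQpos : 0 < 1 / Q := by positivity
  have hr0 : 0 ≤ r := hr ▸ Real.sqrt_nonneg _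
  have hr2 : r ^ 2 = 1 - 1 / Q := by rw [hr, Real.sq_sqrt (by linarith)]
  have hr1 : r < 1 := by nlinarith
  have hlogQ : Real.log Q = -(Real.log (1 - r) + Real.log (1 + r)) := by
    rw [← Real.log_mul (by linarith) (by linarith),
      show (1 - r) * (1 + r) = Q⁻¹ by rw [← one_div]; linarith, Real.log_inv, neg_neg]
  have hγ_lower : 2 * Real.log Q ≤ γ + 1 / γ - 2 := by
    have h := two_mul_log_le_sub_inv ((one_le_inv₀ hγ0).mpr hγ1)
    rw [Real.log_inv, inv_inv] at h
    rw [one_div]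
    linarith
  have h := mul_le_mul_of_nonneg_left hγ_lower (by linarith : 0 ≤ 1 + r)
  rw [hlogQ] at h
  linarith [one_add_mul_log_one_add_le hr0 hr1]
end
end
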